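/- Let δ > 0 and τ > 1. Then the stopping index k*, defined as the smallest integer k ≥ 1 with ‖F(x_k^δ) − y^δ‖² ≤ (2(k+α−1)²/(k(α−3)))Δ(δ) + τ²δ², exists (is finite), and satisfies k* ≤ 2(α−3)·(2ω̄²ρ² + 2ω̄ρδ)/(c₁δ + c₂δ²) + 1; in particular k* = O(δ⁻¹) as δ → 0. -/

import Mathlib

open Metric Filter
open scoped RealInnerProductSpace Topology

/-- First-order characterization of convexity: the graph lies above its tangents. -/
lemma ConvexOn.le_of_hasGradientAt {X : Type*} [NormedAddCommGroup X] [InnerProductSpace ℝ X]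
    [CompleteSpace X] {s : Set X} {f : X → ℝ} (hf : ConvexOn ℝ s f) {a b g : X}
    (ha : a ∈ s) (hb : b ∈ s) (hg : HasGradientAt f g a) :
    f a + ⟪g, b - a⟫ ≤ f b := by
  have hline : HasDerivAt (fun t : ℝ => a + t • (b - a)) (b - a) 0 := by
    simpa using ((hasDerivAt_id (0 : ℝ)).smul_const (b - a)).const_add a
  have hg' : HasFDerivAt f (InnerProductSpace.toDual ℝ X g) (a + (0 : ℝ) • (b - a)) := by
    simpa using hg.hasFDerivAt
  have hd : HasDerivAt (fun t : ℝ => f (a + t • (b - a))) ⟪g, b - a⟫ 0 := by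
    exact hg'.comp_hasDerivAt (0 : ℝ) hline
  have hconv : ConvexOn ℝ (Set.Icc 0 1) (fun t : ℝ => f (a + t • (b - a))) := by
    have h := hf.comp_affineMap (AffineMap.lineMap a b : ℝ →ᵃ[ℝ] X)
    have h2 := h.subset (s := Set.Icc 0 1) (fun t ht => by
      exact hf.1.lineMap_mem ha hb ht) (convex_Icc 0 1)
    refine h2.congr fun t _ => ?_
    simp [AffineMap.lineMap_apply, add_comm]
  have h := hconv.le_slope_of_hasDerivAt (x := 0) (y := 1) (by simp) (by simp) one_pos hd
  simp [slope_def_field] at h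
  linarith

/-- The descent lemma for a function with Lipschitz gradient on a convex set. -/
lemma le_add_inner_add_of_gradient_lipschitz {X : Type*} [NormedAddCommGroup X]
    [InnerProductSpace ℝ X] [CompleteSpace X] {s : Set X} (hs : Convex ℝ s) {f : X → ℝ}
    {g : X → X} {L : ℝ} (hg : ∀ u ∈ s, HasGradientAt f (g u) u)
    (hL : ∀ u ∈ s, ∀ v ∈ s, ‖g u - g v‖ ≤ L * ‖u - v‖) {a b : X} (ha : a ∈ s) (hb : b ∈ s) :
    f b ≤ f a + ⟪g a, b - a⟫ + L / 2 * ‖b - a‖ ^ 2 := by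
  have hmem : ∀ t ∈ Set.Icc (0 : ℝ) 1, a + t • (b - a) ∈ s := fun t ht =>
    hs.add_smul_sub_mem ha hb ht
  have hd : ∀ t ∈ Set.Icc (0 : ℝ) 1, HasDerivAt
      (fun t : ℝ => f (a + t • (b - a)) - t * ⟪g a, b - a⟫ - L / 2 * ‖b - a‖ ^ 2 * t ^ 2)
      (⟪g (a + t • (b - a)), b - a⟫ - ⟪g a, b - a⟫ - L * ‖b - a‖ ^ 2 * t) t := by
    intro t ht
    have hline : HasDerivAt (fun t : ℝ => a + t • (b - a)) (b - a) t := by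
      simpa using ((hasDerivAt_id t).smul_const (b - a)).const_add a
    have h1 : HasDerivAt (fun t : ℝ => f (a + t • (b - a)))
        ⟪g (a + t • (b - a)), b - a⟫ t := by
      exact (hg _ (hmem t ht)).hasFDerivAt.comp_hasDerivAt t hline
    have h2 := (hasDerivAt_id t).mul_const ⟪g a, b - a⟫
    have h3 := (hasDerivAt_pow 2 t).const_mul (L / 2 * ‖b - a‖ ^ 2)
    refine ((h1.sub h2).sub h3).congr_deriv ?_
    simp
    ring
  have hanti := antitoneOn_of_deriv_nonpos (convex_Icc (0 : ℝ) 1)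
    (fun t ht => (hd t ht).continuousAt.continuousWithinAt)
    (fun t ht => (hd t (interior_subset ht)).differentiableAt.differentiableWithinAt)
    (fun t ht => by
      have ht' := interior_subset ht
      rw [(hd t ht').deriv, ← inner_sub_left]
      have h1 := real_inner_le_norm (g (a + t • (b - a)) - g a) (b - a)
      have h2 := hL _ (hmem t ht') a ha
      rw [add_sub_cancel_left, norm_smul, Real.norm_of_nonneg ht'.1] at h2
      nlinarith [norm_nonneg (b - a)])
  have h := hanti (Set.left_mem_Icc.2 zero_le_one) (Set.right_mem_Icc.2 zero_le_one) zero_le_one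
  simp at h
  linarith

/-- The gradient of the least-squares functional `u ↦ ‖F u - y‖² / 2`. -/
lemma HasFDerivAt.hasGradientAt_half_norm_sub_sq {X Y : Type*} [NormedAddCommGroup X]
    [InnerProductSpace ℝ X] [CompleteSpace X] [NormedAddCommGroup Y] [InnerProductSpace ℝ Y]
    [CompleteSpace Y] {F : X → Y} {F' : X →L[ℝ] Y} {u : X} (hF : HasFDerivAt F F' u) (y : Y) :
    HasGradientAt (fun v => (1 / 2) * ‖F v - y‖ ^ 2)
      ((ContinuousLinearMap.adjoint F') (F u - y)) u := by
  rw [hasGradientAt_iff_hasFDerivAt]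
  refine (((hF.sub_const y).norm_sq).const_mul (1 / 2)).congr_fderiv ?_
  ext v
  simp [ContinuousLinearMap.adjoint_inner_left]

/-- One inexact projected gradient step, compared with an arbitrary feasible point. -/
lemma projected_gradient_step_le {X : Type*} [NormedAddCommGroup X] [InnerProductSpace ℝ X]
    [CompleteSpace X] {s C : Set X} {f : X → ℝ} {g : X → X} {L ω : ℝ} (hf : ConvexOn ℝ s f)
    (hg : ∀ u ∈ s, HasGradientAt f (g u) u)
    (hL : ∀ u ∈ s, ∀ v ∈ s, ‖g u - g v‖ ≤ L * ‖u - v‖)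
    (hω : 0 ≤ ω) (hωL : ω * L ≤ 1) (hC : Convex ℝ C) {z e p u : X} (hz : z ∈ s) (hps : p ∈ s)
    (hus : u ∈ s) (hp : p ∈ C) (hu : u ∈ C)
    (hproj : ∀ v ∈ C, ‖z - ω • (g z + e) - p‖ ≤ ‖z - ω • (g z + e) - v‖) :
    ω * (f p - f u) ≤ (‖z - u‖ ^ 2 - ‖p - u‖ ^ 2) / 2 + ω * (‖e‖ * ‖p - u‖) := by
  have h1 := le_add_inner_add_of_gradient_lipschitz hf.1 hg hL hz hps
  have h2 := hf.le_of_hasGradientAt hz hus (hg z hz)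
  have h3 : ⟪z - ω • (g z + e) - p, u - p⟫ ≤ 0 := by
    refine (norm_eq_iInf_iff_real_inner_le_zero hC hp).1 ?_ u hu
    have : Nonempty C := ⟨⟨p, hp⟩⟩
    refine le_antisymm (le_ciInf fun w => hproj w w.2) ?_
    exact ciInf_le ⟨0, by rintro _ ⟨w, rfl⟩; positivity⟩ (⟨p, hp⟩ : C)
  have h4 : ⟪z - ω • (g z + e) - p, u - p⟫ =
      ⟪z - p, u - p⟫ + ω * (⟪g z, p - z⟫ - ⟪g z, u - z⟫) - ω * ⟪e, u - p⟫ := by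
    have : z - ω • (g z + e) - p = (z - p) - ω • g z - ω • e := by module
    rw [this, inner_sub_left, inner_sub_left, real_inner_smul_left, real_inner_smul_left,
      ← inner_sub_right, show p - z - (u - z) = -(u - p) by abel, inner_neg_right]
    ring
  have h5 : ‖z - u‖ ^ 2 = ‖z - p‖ ^ 2 - 2 * ⟪z - p, u - p⟫ + ‖p - u‖ ^ 2 := by
    rw [show z - u = (z - p) - (u - p) by abel, norm_sub_sq_real, norm_sub_rev p u]
  have h6 := (real_inner_le_norm e (u - p))
  rw [norm_sub_rev u p] at h6
  rw [norm_sub_rev p z] at h1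
  have h7 : ω * (f p - f u) ≤
      ω * (⟪g z, p - z⟫ - ⟪g z, u - z⟫) + ω * L * (‖z - p‖ ^ 2 / 2) := by
    have := mul_le_mul_of_nonneg_left (sub_le_sub h1 h2) hω
    linarith
  have h8 := mul_le_mul_of_nonneg_right hωL (by positivity : 0 ≤ ‖z - p‖ ^ 2 / 2)
  have h9 := mul_le_mul_of_nonneg_left h6 hω
  linarith

/-- One inexact accelerated projected gradient step with momentum parameter `t`, in terms of
the auxiliary points `t • z - (t - 1) • x` and `t • p - (t - 1) • x`. -/
lemma accelerated_projected_gradient_step_le {X : Type*} [NormedAddCommGroup X]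
    [InnerProductSpace ℝ X] [CompleteSpace X] {s C : Set X} {f : X → ℝ} {g : X → X}
    {L ω t : ℝ} (hf : ConvexOn ℝ s f) (hg : ∀ u ∈ s, HasGradientAt f (g u) u)
    (hL : ∀ u ∈ s, ∀ v ∈ s, ‖g u - g v‖ ≤ L * ‖u - v‖)
    (hω : 0 ≤ ω) (hωL : ω * L ≤ 1) (ht : 1 ≤ t) (hC : Convex ℝ C) (hCs : C ⊆ s)
    {x z e p q : X} (hz : z ∈ s) (hx : x ∈ C) (hp : p ∈ C) (hq : q ∈ C) (hfq : f q = 0)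
    (hproj : ∀ v ∈ C, ‖z - ω • (g z + e) - p‖ ≤ ‖z - ω • (g z + e) - v‖) :
    ω * t ^ 2 * f p + ‖t • p - (t - 1) • x - q‖ ^ 2 / 2 ≤
      ω * (t ^ 2 - t) * f x + ‖t • z - (t - 1) • x - q‖ ^ 2 / 2 +
        ω * t * (‖e‖ * ‖t • p - (t - 1) • x - q‖) := by
  have ht0 : 0 < t := by linarith
  have htne := ht0.ne'
  have hw1 : 0 ≤ 1 - t⁻¹ := by
    have := inv_le_one_of_one_le₀ ht
    linarith
  have hw2 : 0 ≤ t⁻¹ := by positivity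
  set u := (1 - t⁻¹) • x + t⁻¹ • q with hu
  have huC : u ∈ C := hC hx hq hw1 hw2 (by ring)
  have hfu : f u ≤ (1 - t⁻¹) * f x := by
    have := hf.2 (hCs hx) (hCs hq) hw1 hw2 (by ring)
    simpa [hfq] using this
  have hstep := projected_gradient_step_le hf hg hL hω hωL hC hz (hCs hp) (hCs huC) hp huC hproj
  have hn : ∀ w : X, ‖t • w - (t - 1) • x - q‖ = t * ‖w - u‖ := by
    intro w
    rw [← Real.norm_of_nonneg ht0.le, ← norm_smul, Real.norm_of_nonneg ht0.le]
    congr 1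
    rw [hu, smul_sub, smul_add, smul_smul, smul_smul, mul_sub, mul_inv_cancel₀ htne]
    module
  rw [hn p, hn z]
  have h1 := mul_le_mul_of_nonneg_left hfu (by positivity : 0 ≤ ω * t ^ 2)
  have h2 := mul_le_mul_of_nonneg_left hstep (by positivity : 0 ≤ t ^ 2)
  have h3 : ω * t ^ 2 * ((1 - t⁻¹) * f x) = ω * (t ^ 2 - t) * f x := by
    field_simp
  linarith

/-- If every iterate `x k` with `1 ≤ k ≤ K` of an inexact projected Nesterov iteration has
objective value dominating the accumulated gradient noise of size `η`, then the iterates up to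
index `K + 1` stay within distance `2 * ρ` of the minimizer `q`. -/
lemma nesterov_iterate_dist_le {X : Type*} [NormedAddCommGroup X] [InnerProductSpace ℝ X]
    [CompleteSpace X] {s C : Set X} {f : X → ℝ} {g : X → X} {L ω α ρ η : ℝ}
    (hf : ConvexOn ℝ s f) (hg : ∀ u ∈ s, HasGradientAt f (g u) u)
    (hL : ∀ u ∈ s, ∀ v ∈ s, ‖g u - g v‖ ≤ L * ‖u - v‖)
    (hf0 : ∀ u, 0 ≤ f u) (hω : 0 ≤ ω) (hωL : ω * L ≤ 1) (hα : 3 < α)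
    (hC : Convex ℝ C) (hCs : C ⊆ s) (hρ : 0 ≤ ρ) (hη : 0 ≤ η) (hηρ : ω * η ≤ ρ / 8)
    {q : X} (hq : q ∈ C) (hfq : f q = 0)
    {x z e : ℕ → X} (hxC : ∀ k, x k ∈ C) (hzs : ∀ k, z k ∈ s) (he : ∀ k, ‖e k‖ ≤ η)
    (hz : ∀ k : ℕ, z k = x k + (((k : ℝ) - 1) / ((k : ℝ) + α - 1)) • (x k - x (k - 1)))
    (hproj : ∀ k, ∀ v ∈ C, ‖z k - ω • (g (z k) + e k) - x (k + 1)‖ ≤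
      ‖z k - ω • (g (z k) + e k) - v‖)
    (hx0 : ‖x 0 - q‖ ≤ ρ) (hx1 : ‖x 1 - q‖ ≤ 3 * ρ)
    (hdiam : ∀ u ∈ C, ∀ v ∈ C, ‖u - v‖ ≤ 4 * ρ) {K : ℕ}
    (hlow : ∀ k : ℕ, 1 ≤ k → k ≤ K →
      4 * ρ * η * ((k : ℝ) + α - 1) ^ 2 ≤ (k : ℝ) * (α - 3) * f (x k)) :
    ∀ k ≤ K + 1, ‖x k - q‖ ≤ 2 * ρ := by
  have hα1 : 0 < α - 1 := by linarith
  obtain ⟨T, hT⟩ : ∃ T : ℕ → ℝ, ∀ k, T k = ((k : ℝ) + α - 1) / (α - 1) := ⟨_, fun _ => rfl⟩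
  obtain ⟨w, hw⟩ : ∃ w : ℕ → X, ∀ k, w k = T k • x (k + 1) - (T k - 1) • x k - q :=
    ⟨_, fun _ => rfl⟩
  have hT1 : ∀ k, 1 ≤ T k := by
    intro k
    rw [hT, le_div_iff₀ hα1]
    have : (0 : ℝ) ≤ k := k.cast_nonneg
    linarith
  have hT0 : T 0 = 1 := by
    rw [hT]
    field_simp
    simp
  have hstep : ∀ k, ω * T k ^ 2 * f (x (k + 1)) + ‖w k‖ ^ 2 / 2 ≤
      ω * (T k ^ 2 - T k) * f (x k) + ‖T k • z k - (T k - 1) • x k - q‖ ^ 2 / 2 +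
        ω * T k * (η * ‖w k‖) := by
    intro k
    have h := accelerated_projected_gradient_step_le hf hg hL hω hωL (hT1 k) hC hCs (hzs k)
      (hxC k) (hxC (k + 1)) hq hfq (hproj k)
    rw [← hw] at h
    have h2 : ω * T k * (‖e k‖ * ‖w k‖) ≤ ω * T k * (η * ‖w k‖) := by
      have := hT1 k
      have := he k
      gcongr
    linarith
  have hwz : ∀ m, T (m + 1) • z (m + 1) - (T (m + 1) - 1) • x (m + 1) - q = w m := by
    intro m
    have hm : (0 : ℝ) ≤ m := m.cast_nonneg
    have h1 : T (m + 1) * (((m + 1 : ℕ) : ℝ) - 1) / (((m + 1 : ℕ) : ℝ) + α - 1) = T m - 1 := by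
      rw [hT, hT]
      push_cast
      have : (m : ℝ) + 1 + α - 1 ≠ 0 := by linarith
      field_simp
      ring
    rw [hz, hw, smul_add, smul_smul, ← mul_div_assoc, h1, Nat.add_sub_cancel]
    module
  have hwle : ∀ k, ‖w k‖ ≤ 4 * ρ * T k := by
    intro k
    have hTk := hT1 k
    have h1 : w k = (x (k + 1) - q) + (T k - 1) • (x (k + 1) - x k) := by
      rw [hw]
      module
    have h2 := norm_add_le (x (k + 1) - q) ((T k - 1) • (x (k + 1) - x k))
    rw [← h1, norm_smul, Real.norm_of_nonneg (by linarith)] at h2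
    have h3 := hdiam _ (hxC (k + 1)) _ hq
    have h4 := mul_le_mul_of_nonneg_left (hdiam _ (hxC (k + 1)) _ (hxC k))
      (by linarith : 0 ≤ T k - 1)
    linarith
  have henergy : ∀ m ≤ K, ω * T m ^ 2 * f (x (m + 1)) + ‖w m‖ ^ 2 / 2 ≤ 2 * ρ ^ 2 := by
    intro m
    induction m with
    | zero =>
      intro _
      have h := hstep 0
      have hw0 : w 0 = x 1 - q := by
        rw [hw, hT0]
        simp
      have hz0 : z 0 = x 0 := by
        rw [hz]
        simp
      rw [hz0, hT0] at h
      rw [hT0]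
      have h1 : ω * 1 * (η * ‖w 0‖) ≤ ρ / 8 * (3 * ρ) := by
        rw [hw0, mul_one, ← mul_assoc]
        gcongr
      have h2 : ‖x 0 - q‖ ^ 2 ≤ ρ ^ 2 := by gcongr
      simp only [one_pow, sub_self, mul_zero, zero_mul, zero_smul, one_smul, sub_zero,
        zero_add] at h h1 ⊢
      nlinarith [sq_nonneg ρ]
    | succ m ih =>
      intro hm
      have hi := ih (by omega)
      have h := hstep (m + 1)
      rw [hwz] at h
      have hl := hlow (m + 1) (by omega) hm
      have hTm := hT1 (m + 1)
      have hcoef : (T m ^ 2 - (T (m + 1) ^ 2 - T (m + 1))) * (α - 1) ^ 2 =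
          ((m + 1 : ℕ) : ℝ) * (α - 3) + (α - 2) ^ 2 := by
        rw [hT, hT]
        push_cast
        field_simp
        ring
      have hTe : T (m + 1) ^ 2 * (α - 1) ^ 2 = (((m + 1 : ℕ) : ℝ) + α - 1) ^ 2 := by
        rw [hT]
        field_simp
      have hnoise : 4 * ρ * η * T (m + 1) ^ 2 ≤
          (T m ^ 2 - (T (m + 1) ^ 2 - T (m + 1))) * f (x (m + 1)) := by
        refine le_of_mul_le_mul_right ?_ (by positivity : 0 < (α - 1) ^ 2)
        calc 4 * ρ * η * T (m + 1) ^ 2 * (α - 1) ^ 2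
            = 4 * ρ * η * (((m + 1 : ℕ) : ℝ) + α - 1) ^ 2 := by rw [mul_assoc, hTe]
          _ ≤ (((m + 1 : ℕ) : ℝ) * (α - 3) + (α - 2) ^ 2) * f (x (m + 1)) := by
            have := mul_nonneg (sq_nonneg (α - 2)) (hf0 (x (m + 1)))
            linarith
          _ = (T m ^ 2 - (T (m + 1) ^ 2 - T (m + 1))) * f (x (m + 1)) * (α - 1) ^ 2 := by
            rw [← hcoef]
            ring
      have h1 : ω * T (m + 1) * (η * ‖w (m + 1)‖) ≤
          ω * T (m + 1) * (η * (4 * ρ * T (m + 1))) := by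
        have := hwle (m + 1)
        gcongr
      have h2 := mul_le_mul_of_nonneg_left hnoise hω
      linarith
  intro k
  induction k with
  | zero =>
    intro _
    linarith
  | succ m ih =>
    intro hm
    have hTm := hT1 m
    have hE := henergy m (by omega)
    have h1 : ‖w m‖ ≤ 2 * ρ := by
      refine le_of_sq_le_sq ?_ (by positivity)
      have : 0 ≤ ω * T m ^ 2 * f (x (m + 1)) := by
        have := hf0 (x (m + 1))
        positivity
      linarith
    have h2 : T m • (x (m + 1) - q) = w m + (T m - 1) • (x m - q) := by
      rw [hw]
      module
    have h3 := norm_add_le (w m) ((T m - 1) • (x m - q))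
    rw [← h2, norm_smul, norm_smul, Real.norm_of_nonneg (by linarith),
      Real.norm_of_nonneg (by linarith)] at h3
    have h4 := mul_le_mul_of_nonneg_left (ih (by omega)) (by linarith : 0 ≤ T m - 1)
    refine le_of_mul_le_mul_left ?_ (by linarith : 0 < T m)
    linarith

/-- The stopping index `k*` — the smallest `k ≥ 1` with
`‖F(x_k^δ) − y^δ‖² ≤ (2(k+α−1)²/(k(α−3)))Δ(δ) + τ²δ²` — exists and satisfies
`k* ≤ 2(α−3)(2ω̄²ρ² + 2ω̄ρδ)/(c₁δ + c₂δ²) + 1`; in particular `k* = O(δ⁻¹)`. -/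
theorem nesterov_stopping_index_well_defined
    {X Y : Type*} [NormedAddCommGroup X] [InnerProductSpace ℝ X] [CompleteSpace X]
    [NormedAddCommGroup Y] [InnerProductSpace ℝ Y] [CompleteSpace Y]
    (x₀ : X) (ρ : ℝ) (hρ : 0 < ρ)
    (F : X → Y) (F' : X → X →L[ℝ] Y)
    (hF : ∀ u ∈ closedBall x₀ (6 * ρ), HasFDerivAt F (F' u) u)
    (ωb : ℝ) (hωb : ∀ u ∈ closedBall x₀ (6 * ρ), ‖F' u‖ ≤ ωb)
    (y : Y) (xstar : X) (hxstar : xstar ∈ closedBall x₀ ρ) (hFxstar : F xstar = y)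
    (δ : ℝ) (hδpos : 0 < δ) (yδ : Y) (hδ : ‖y - yδ‖ ≤ δ)
    (τ : ℝ) (hτ : 1 < τ)
    (Φ0 : X → ℝ)
    (hΦ0 : ∀ u, Φ0 u = (1 / 2) * ‖F u - y‖ ^ 2)
    (hconv : ConvexOn ℝ (closedBall x₀ (6 * ρ)) Φ0)
    (L : ℝ) (hL : 0 < L)
    (hLip : ∀ u ∈ closedBall x₀ (6 * ρ), ∀ v ∈ closedBall x₀ (6 * ρ),
      ‖(ContinuousLinearMap.adjoint (F' u)) (F u - y) -
        (ContinuousLinearMap.adjoint (F' v)) (F v - y)‖ ≤ L * ‖u - v‖)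
    (α ω : ℝ) (hα : 3 < α) (hω : 0 < ω) (hωL : ω < 1 / L)
    (P : X → X)
    (hP_mem : ∀ u, P u ∈ closedBall x₀ (2 * ρ))
    (hP_proj : ∀ u, ∀ v ∈ closedBall x₀ (2 * ρ), ‖u - P u‖ ≤ ‖u - v‖)
    (x z : ℕ → X)
    (hx0 : x 0 = x₀)
    (hz : ∀ k : ℕ, z k = x k + (((k : ℝ) - 1) / ((k : ℝ) + α - 1)) • (x k - x (k - 1)))
    (hx : ∀ k : ℕ, x (k + 1) = P (z k + ω • (ContinuousLinearMap.adjoint (F' (z k))) (yδ - F (z k))))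
    (c₁ c₂ Δ : ℝ)
    (hc₁ : c₁ = 2 * ωb ^ 3 * ω * ρ + 20 * ρ * ωb)
    (hc₂ : c₂ = 3 + (1 / 2) * ωb ^ 4 * ω ^ 2 + (1 / 2) * ω * ωb ^ 2)
    (hΔ : Δ = c₁ * δ + c₂ * δ ^ 2) :
    ∃ ks : ℕ, 1 ≤ ks ∧
      (‖F (x ks) - yδ‖ ^ 2
        ≤ 2 * ((ks : ℝ) + α - 1) ^ 2 / ((ks : ℝ) * (α - 3)) * Δ + τ ^ 2 * δ ^ 2) ∧
      (∀ k : ℕ, 1 ≤ k → k < ks →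
        ¬ (‖F (x k) - yδ‖ ^ 2
            ≤ 2 * ((k : ℝ) + α - 1) ^ 2 / ((k : ℝ) * (α - 3)) * Δ + τ ^ 2 * δ ^ 2)) ∧
      (ks : ℝ) ≤ 2 * (α - 3) * (2 * ωb ^ 2 * ρ ^ 2 + 2 * ωb * ρ * δ) / (c₁ * δ + c₂ * δ ^ 2) + 1 := by
  have hωb0 : 0 ≤ ωb :=
    (norm_nonneg _).trans (hωb x₀ (mem_closedBall_self (by positivity)))
  have hα3 : 0 < α - 3 := by linarith
  have hsub : closedBall x₀ (2 * ρ) ⊆ closedBall x₀ (6 * ρ) :=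
    closedBall_subset_closedBall (by linarith)
  have hxC : ∀ k, x k ∈ closedBall x₀ (2 * ρ) := by
    rintro (_ | k)
    · rw [hx0]
      exact mem_closedBall_self (by positivity)
    · rw [hx]
      exact hP_mem _
  have hq : xstar ∈ closedBall x₀ (2 * ρ) :=
    closedBall_subset_closedBall (by linarith) hxstar
  have hq1 : ‖x₀ - xstar‖ ≤ ρ := by
    rw [norm_sub_rev]
    exact mem_closedBall_iff_norm.1 hxstar
  have hball : ∀ u ∈ closedBall x₀ (2 * ρ), ‖u - xstar‖ ≤ 3 * ρ := by
    intro u hu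
    have h1 := norm_sub_le_norm_sub_add_norm_sub u x₀ xstar
    have h2 := mem_closedBall_iff_norm.1 hu
    linarith
  have hdiam : ∀ u ∈ closedBall x₀ (2 * ρ), ∀ v ∈ closedBall x₀ (2 * ρ), ‖u - v‖ ≤ 4 * ρ := by
    intro u hu v hv
    have h1 := norm_sub_le_norm_sub_add_norm_sub u x₀ v
    have h2 := mem_closedBall_iff_norm.1 hu
    have h3 := mem_closedBall_iff_norm'.1 hv
    linarith
  have hzs : ∀ k, z k ∈ closedBall x₀ (6 * ρ) := by
    intro k
    rw [mem_closedBall_iff_norm, hz]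
    have h1 := mem_closedBall_iff_norm.1 (hxC k)
    rcases Nat.eq_zero_or_pos k with rfl | hk
    · simp only [zero_tsub, sub_self, smul_zero, add_zero]
      linarith
    · have hk1 : (1 : ℝ) ≤ k := by exact_mod_cast hk
      have hβ0 : 0 ≤ ((k : ℝ) - 1) / ((k : ℝ) + α - 1) := div_nonneg (by linarith) (by linarith)
      have hβ1 : ((k : ℝ) - 1) / ((k : ℝ) + α - 1) ≤ 1 :=
        div_le_one_of_le₀ (by linarith) (by linarith)
      have h2 := hdiam _ (hxC k) _ (hxC (k - 1))
      have h3 := norm_add_le (x k - x₀)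
        ((((k : ℝ) - 1) / ((k : ℝ) + α - 1)) • (x k - x (k - 1)))
      rw [norm_smul, Real.norm_of_nonneg hβ0] at h3
      have h4 := mul_le_mul hβ1 h2 (norm_nonneg _) zero_le_one
      rw [add_sub_right_comm]
      linarith
  have hFlip : ∀ k, ‖F (x k) - y‖ ≤ ωb * ‖x k - xstar‖ := by
    intro k
    rw [← hFxstar]
    exact (convex_closedBall x₀ (6 * ρ)).norm_image_sub_le_of_norm_hasFDerivWithin_le
      (fun u hu => (hF u hu).hasFDerivWithinAt) hωb (hsub hq) (hsub (hxC k))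
  have hres : ∀ (k : ℕ) (r : ℝ), ‖x k - xstar‖ ≤ r →
      ‖F (x k) - yδ‖ ^ 2 ≤ (ωb * r + δ) ^ 2 := by
    intro k r hr
    have h1 := norm_sub_le_norm_sub_add_norm_sub (F (x k)) y yδ
    have h2 := mul_le_mul_of_nonneg_left hr hωb0
    have h3 := hFlip k
    gcongr
    linarith
  have hΔlow : 20 * ρ * ωb * δ + 3 * δ ^ 2 + 2 * (ωb ^ 3 * ω * ρ * δ) ≤ Δ := by
    rw [hΔ, hc₁, hc₂]
    have h : 0 ≤ ((1 / 2) * ωb ^ 4 * ω ^ 2 + (1 / 2) * ω * ωb ^ 2) * δ ^ 2 := by positivity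
    linarith
  have hΔpos : 0 < Δ := by
    have h1 : 0 ≤ 20 * ρ * ωb * δ := by positivity
    have h2 : 0 ≤ 2 * (ωb ^ 3 * ω * ρ * δ) := by positivity
    have h3 : 0 < δ ^ 2 := by positivity
    linarith
  have hτδ : δ ^ 2 ≤ τ ^ 2 * δ ^ 2 := by
    have : 1 ≤ τ ^ 2 := one_le_pow₀ hτ.le
    nlinarith [sq_nonneg δ]
  rw [← hΔ]
  set A : ℝ := 2 * (α - 3) * (2 * ωb ^ 2 * ρ ^ 2 + 2 * ωb * ρ * δ) / Δ with hA
  have hA0 : 0 ≤ A := by positivity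
  have hAΔ : A * Δ = (α - 3) * (4 * ωb ^ 2 * ρ ^ 2 + 4 * ωb * ρ * δ) := by
    rw [hA]
    field_simp
    ring
  suffices hex : ∃ k : ℕ, (1 ≤ k ∧ ‖F (x k) - yδ‖ ^ 2
      ≤ 2 * ((k : ℝ) + α - 1) ^ 2 / ((k : ℝ) * (α - 3)) * Δ + τ ^ 2 * δ ^ 2) ∧
      (k : ℝ) ≤ A + 1 by
    obtain ⟨k, hk, hkA⟩ := hex
    classical
    have hex' : ∃ k : ℕ, 1 ≤ k ∧ ‖F (x k) - yδ‖ ^ 2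
      ≤ 2 * ((k : ℝ) + α - 1) ^ 2 / ((k : ℝ) * (α - 3)) * Δ + τ ^ 2 * δ ^ 2 := ⟨k, hk⟩
    refine ⟨Nat.find hex', (Nat.find_spec hex').1, (Nat.find_spec hex').2,
      fun j hj1 hj hj2 => Nat.find_min hex' hj ⟨hj1, hj2⟩, ?_⟩
    have : (Nat.find hex' : ℝ) ≤ k := by exact_mod_cast Nat.find_min' hex' hk
    linarith
  by_contra! hnot
  set N : ℕ := ⌊A⌋₊
  have hNA : (N : ℝ) ≤ A := Nat.floor_le hA0
  have hAN : A < (N : ℝ) + 1 := Nat.lt_floor_add_one A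
  have hbefore : ∀ k : ℕ, 1 ≤ k → k ≤ N + 1 →
      2 * ((k : ℝ) + α - 1) ^ 2 / ((k : ℝ) * (α - 3)) * Δ + τ ^ 2 * δ ^ 2 <
        ‖F (x k) - yδ‖ ^ 2 := by
    intro k hk1 hkN
    by_contra! h
    have h1 := hnot k ⟨hk1, h⟩
    have h2 : (k : ℝ) ≤ N + 1 := by exact_mod_cast hkN
    linarith
  have hlast : 8 * ωb ^ 2 * ρ ^ 2 + 8 * ωb * ρ * δ + 4 * Δ + δ ^ 2 < ‖F (x (N + 1)) - yδ‖ ^ 2 := by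
    have h1 := hbefore (N + 1) (by omega) le_rfl
    have hk0 : (0 : ℝ) < ((N + 1 : ℕ) : ℝ) := by positivity
    have hkA : A ≤ ((N + 1 : ℕ) : ℝ) := by
      push_cast
      exact hAN.le
    generalize ((N + 1 : ℕ) : ℝ) = κ at h1 hk0 hkA
    have h2 : (2 * κ + 4 * (α - 3)) / (α - 3) ≤ 2 * (κ + α - 1) ^ 2 / (κ * (α - 3)) := by
      rw [div_le_div_iff₀ hα3 (by positivity)]
      have : (2 * κ + 4 * (α - 3)) * κ ≤ 2 * (κ + α - 1) ^ 2 := by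
        nlinarith [sq_nonneg (α - 1)]
      nlinarith
    have h3 := mul_le_mul_of_nonneg_right h2 hΔpos.le
    have h4 : 8 * ωb ^ 2 * ρ ^ 2 + 8 * ωb * ρ * δ + 4 * Δ ≤
        (2 * κ + 4 * (α - 3)) / (α - 3) * Δ := by
      rw [div_mul_eq_mul_div, le_div_iff₀ hα3]
      have := mul_le_mul_of_nonneg_right hkA hΔpos.le
      linarith
    linarith
  have hωρδ : 0 ≤ ωb * ρ * δ := by positivity
  have hsmall : 4 * Δ < ωb ^ 2 * ρ ^ 2 := by
    have h := hres (N + 1) _ (hball _ (hxC (N + 1)))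
    linarith
  have hnoise : ω * (ωb * δ) ≤ ρ / 8 := by
    have hpos : 0 < ωb ^ 2 * ρ := by
      have h : 0 < ωb ^ 2 * ρ * ρ := by linarith
      exact pos_of_mul_pos_left h hρ.le
    refine le_of_mul_le_mul_left ?_ hpos
    have : 0 ≤ 20 * ρ * ωb * δ := by positivity
    linarith [sq_nonneg δ]
  have hΦ0' : Φ0 = fun u => (1 / 2) * ‖F u - y‖ ^ 2 := funext hΦ0
  have hgrad : ∀ u ∈ closedBall x₀ (6 * ρ),
      HasGradientAt Φ0 ((ContinuousLinearMap.adjoint (F' u)) (F u - y)) u := by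
    intro u hu
    rw [hΦ0']
    exact (hF u hu).hasGradientAt_half_norm_sub_sq y
  have hadj : ∀ k, z k + ω • (ContinuousLinearMap.adjoint (F' (z k))) (yδ - F (z k)) =
      z k - ω • ((ContinuousLinearMap.adjoint (F' (z k))) (F (z k) - y) +
        (ContinuousLinearMap.adjoint (F' (z k))) (y - yδ)) := by
    intro k
    rw [← map_add, sub_add_sub_cancel, ← neg_sub (F (z k)) yδ, map_neg, smul_neg,
      ← sub_eq_add_neg]
  have hdist := nesterov_iterate_dist_le (K := N) (η := ωb * δ)
    (g := fun u => (ContinuousLinearMap.adjoint (F' u)) (F u - y))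
    (e := fun k => (ContinuousLinearMap.adjoint (F' (z k))) (y - yδ))
    hconv hgrad hLip (fun u => by rw [hΦ0]; positivity) hω.le
    ((lt_div_iff₀ hL).1 hωL).le hα (convex_closedBall x₀ (2 * ρ)) hsub hρ.le (by positivity)
    hnoise hq (by rw [hΦ0, hFxstar]; simp) hxC hzs
    (fun k => by
      refine (ContinuousLinearMap.le_opNorm _ _).trans ?_
      rw [LinearIsometryEquiv.norm_map]
      exact mul_le_mul (hωb _ (hzs k)) hδ (norm_nonneg _) hωb0)
    hz
    (fun k v hv => by
      rw [← hadj, hx k]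
      exact hP_proj _ v hv)
    (by rw [hx0]; exact hq1) (hball _ (hxC 1)) hdiam
    (fun k hk1 hkN => by
      have h1 := hbefore k hk1 (by omega)
      have hk0 : (1 : ℝ) ≤ k := by exact_mod_cast hk1
      rw [hΦ0]
      generalize (k : ℝ) = κ at h1 hk0
      have hκ : 0 < κ * (α - 3) := by positivity
      have h2 := norm_sub_le_norm_sub_add_norm_sub (F (x k)) y yδ
      have h3 : ‖F (x k) - yδ‖ ^ 2 ≤ 2 * ‖F (x k) - y‖ ^ 2 + 2 * δ ^ 2 := by
        have : ‖F (x k) - yδ‖ ^ 2 ≤ (‖F (x k) - y‖ + δ) ^ 2 := by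
          gcongr
          linarith
        linarith [sq_nonneg (‖F (x k) - y‖ - δ)]
      have h4 : κ * (α - 3) ≤ (κ + α - 1) ^ 2 := by
        linarith [sq_nonneg κ, sq_nonneg (α - 1)]
      have h5 : 2 * (κ + α - 1) ^ 2 / (κ * (α - 3)) * Δ < 2 * ‖F (x k) - y‖ ^ 2 + δ ^ 2 := by
        linarith
      rw [div_mul_eq_mul_div, div_lt_iff₀ hκ] at h5
      have h6 : (κ + α - 1) ^ 2 * (20 * (ωb * ρ * δ) + 3 * δ ^ 2) ≤ (κ + α - 1) ^ 2 * Δ := by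
        have h7 : 0 ≤ ωb ^ 3 * ω * ρ * δ := by positivity
        exact mul_le_mul_of_nonneg_left (by linarith) (sq_nonneg _)
      have h8 := mul_le_mul_of_nonneg_right h4 (sq_nonneg δ)
      have h9 := mul_nonneg (sq_nonneg (κ + α - 1)) hωρδ
      have h10 := mul_nonneg (sq_nonneg (κ + α - 1)) (sq_nonneg δ)
      linarith)
  have h := hres (N + 1) _ (hdist (N + 1) le_rfl)
  linarith [sq_nonneg (ωb * ρ)]
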